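/- arXiv:2109.13390 — 2 statements merged into one kernel-verified Lean document; each statement's English description precedes it below -/
import Mathlib

section
/- Let 2/3 < α < 1 and let u be a smooth axially symmetric solution of α P_4 u + 6(1 - e^{4u}/∫_{S^4} e^{4u} dw) = 0 on S^4 (equivalently, u = u(x) solves α[(1-x^2)^2 u']''' + 6 - 8e^{4u}/∫_{-1}^1(1-x^2)e^{4u} = 0 on (-1,1)). Then u is constant. -/
open Set Filter Topology intervalIntegral in
/-- The sharp Poincaré inequality for the ultraspherical weight `1 - x ^ 2`, that is, the spectral
gap `4` of `-Δ` on axially symmetric functions on `S⁴`. -/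
theorem four_mul_integral_le_of_integral_eq_zero {G g : ℝ → ℝ}
    (hG : ∀ x, HasDerivAt G (g x) x) (hg : Continuous g)
    (h0 : ∫ x in (-1 : ℝ)..1, (1 - x ^ 2) * G x = 0) :
    4 * ∫ x in (-1 : ℝ)..1, (1 - x ^ 2) * G x ^ 2 ≤
      ∫ x in (-1 : ℝ)..1, (1 - x ^ 2) ^ 2 * g x ^ 2 := by
  have hGc : Continuous G := continuous_iff_continuousAt.2 fun x => (hG x).continuousAt
  have hFc : Continuous fun x : ℝ => (1 - x ^ 2) * G x := by fun_prop
  set Φ : ℝ → ℝ := fun x => ∫ t in (-1 : ℝ)..x, (1 - t ^ 2) * G t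
  have hΦ : ∀ x, HasDerivAt Φ ((1 - x ^ 2) * G x) x := fun x =>
    integral_hasDerivAt_right (hFc.intervalIntegrable _ _)
      hFc.stronglyMeasurable.stronglyMeasurableAtFilter hFc.continuousAt
  have hΦc : Continuous Φ := continuous_iff_continuousAt.2 fun x => (hΦ x).continuousAt
  have hΦ1 : Φ 1 = 0 := h0
  have hΦ2 : Φ (-1) = 0 := integral_same
  have hw : ∀ x ∈ Ioo (-1 : ℝ) 1, 0 < 1 - x ^ 2 := fun x hx => by nlinarith [hx.1, hx.2]
  have hend : ∀ a : ℝ, a ^ 2 = 1 → Φ a = 0 → ContinuousAt (fun x => Φ x / (1 - x ^ 2)) a := by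
    intro a ha hΦa
    have hd : HasDerivAt Φ 0 a := by simpa [ha] using hΦ a
    have hs : ContinuousAt (dslope Φ a) a := continuousAt_dslope_same.2 hd.differentiableAt
    have hne : -(a + a) ≠ 0 := by
      intro h
      have : a = 0 := by linarith
      simp [this] at ha
    have hq : ContinuousAt (fun x => dslope Φ a x / (-(x + a))) a :=
      hs.div (by fun_prop) hne
    refine hq.congr (Eventually.of_forall fun x => ?_)
    rcases eq_or_ne x a with rfl | hx
    · simp [dslope_same, hd.deriv, ha]
    · have hxa : x - a ≠ 0 := sub_ne_zero.2 hx
      have : (1 - x ^ 2) = (x - a) * (-(x + a)) := by rw [← ha]; ring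
      simp only [dslope_of_ne _ hx, slope_def_field, hΦa, sub_zero, this, div_div]
  have hqc : ContinuousOn (fun x => Φ x / (1 - x ^ 2)) (Icc (-1) 1) := by
    intro x hx
    rcases eq_or_lt_of_le hx.1 with h | h
    · exact (hend x (by rw [← h]; norm_num) (by rw [← h, hΦ2])).continuousWithinAt
    rcases eq_or_lt_of_le hx.2 with h' | h'
    · exact (hend x (by rw [h']; norm_num) (by rw [h', hΦ1])).continuousWithinAt
    have : ContinuousAt (fun x : ℝ => 1 - x ^ 2) x := by fun_prop
    exact (hΦc.continuousAt.div this (hw x ⟨h, h'⟩).ne').continuousWithinAt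
  have key := sub_le_integral_of_hasDeriv_right_of_le (a := (-1 : ℝ)) (b := 1)
    (g := fun x => -(8 * Φ x * G x + 16 * x * (Φ x / (1 - x ^ 2)) ^ 2))
    (g' := fun x => -(8 * ((1 - x ^ 2) * G x) * G x + 8 * Φ x * g x
      + (16 * (Φ x / (1 - x ^ 2)) ^ 2 + 16 * x * (2 * (Φ x / (1 - x ^ 2)) *
        (((1 - x ^ 2) * G x * (1 - x ^ 2) - Φ x * (-(2 * x))) / (1 - x ^ 2) ^ 2)))))
    (φ := fun x => (1 - x ^ 2) ^ 2 * g x ^ 2 - 4 * ((1 - x ^ 2) * G x ^ 2))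
    (by norm_num) ?_ ?_ ?_ ?_
  · rw [integral_sub ((by fun_prop : Continuous _).intervalIntegrable _ _)
      ((by fun_prop : Continuous _).intervalIntegrable _ _), integral_const_mul] at key
    simp only [hΦ1, hΦ2] at key
    norm_num at key
    exact key
  · exact (((continuousOn_const.mul hΦc.continuousOn).mul hGc.continuousOn).add
      ((continuousOn_const.mul continuousOn_id).mul (hqc.pow 2))).neg
  · intro x hx
    have hpoly : HasDerivAt (fun y : ℝ => 1 - y ^ 2) (-(2 * x)) x := by
      simpa using ((hasDerivAt_id x).pow 2).const_sub 1
    have hq := ((hΦ x).div hpoly (hw x hx).ne').pow 2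
    have := ((((hΦ x).const_mul 8).mul (hG x)).add
      (((hasDerivAt_id x).const_mul 16).mul hq)).neg
    refine (this.congr_deriv ?_).hasDerivWithinAt
    simp
  · exact (by fun_prop : Continuous _).continuousOn.integrableOn_Icc
  · intro x hx
    have hpos := hw x hx
    have h1 := sq_nonneg ((1 - x ^ 2) * g x + 4 * (Φ x / (1 - x ^ 2)))
    have h2 : 0 ≤ 4 * ((1 - x ^ 2) * (G x + 4 * x * (Φ x / (1 - x ^ 2) ^ 2)) ^ 2) := by positivity
    have h3 := add_nonneg h1 h2
    rw [← sub_nonneg]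
    refine h3.trans_eq ?_
    field_simp
    ring

/-- If the third derivative of `k₀` is nonnegative and `k₀` vanishes at `±1`, then
`k₀ / (1 - x ^ 2)` is nonincreasing. -/
theorem deriv_mul_add_nonpos_of_third_deriv_nonneg {k₀ k₁ k₂ k₃ : ℝ → ℝ}
    (h₀ : ∀ x, HasDerivAt k₀ (k₁ x) x) (h₁ : ∀ x, HasDerivAt k₁ (k₂ x) x)
    (h₂ : ∀ x, HasDerivAt k₂ (k₃ x) x) (h₃ : ∀ x ∈ Set.Ioo (-1 : ℝ) 1, 0 ≤ k₃ x)
    (hl : k₀ (-1) = 0) (hr : k₀ 1 = 0) {x : ℝ} (hx : x ∈ Set.Icc (-1 : ℝ) 1) :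
    (1 - x ^ 2) * k₁ x + 2 * x * k₀ x ≤ 0 := by
  have hM : ∀ y : ℝ, MonotoneOn
      (fun t => k₀ t + k₁ t * (y - t) + k₂ t * ((y - t) ^ 2 / 2)) (Set.Icc (-1) 1) := by
    intro y
    have hd : ∀ t, HasDerivAt (fun t => k₀ t + k₁ t * (y - t) + k₂ t * ((y - t) ^ 2 / 2))
        (k₃ t * ((y - t) ^ 2 / 2)) t := by
      intro t
      have hlin : HasDerivAt (fun t => y - t) (-1) t := (hasDerivAt_id t).const_sub y
      refine (((h₀ t).add ((h₁ t).mul hlin)).add 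
        ((h₂ t).mul ((hlin.pow 2).div_const 2))).congr_deriv ?_
      simp
      ring
    refine monotoneOn_of_deriv_nonneg (convex_Icc _ _)
      (fun t _ => (hd t).continuousAt.continuousWithinAt)
      (fun t _ => (hd t).differentiableAt.differentiableWithinAt) fun t ht => ?_
    rw [interior_Icc] at ht
    rw [(hd t).deriv]
    exact mul_nonneg (h₃ t ht) (by positivity)
  have hR := hM 1 hx (Set.right_mem_Icc.2 (by norm_num)) hx.2
  have hL := hM (-1) (Set.left_mem_Icc.2 (by norm_num)) hx hx.1
  simp only [hl, hr] at hR hL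
  norm_num at hR hL
  nlinarith [mul_le_mul_of_nonneg_left hR (sq_nonneg (1 + x)),
    mul_le_mul_of_nonneg_left hL (sq_nonneg (1 - x))]

section EulerLagrange

variable {α : ℝ} {g : ℕ → ℝ → ℝ}

theorem hasDerivAt_weight (x : ℝ) : HasDerivAt (fun y : ℝ => 1 - y ^ 2) (-2 * x) x := by
  refine (((hasDerivAt_id x).pow 2).const_sub 1).congr_deriv ?_
  simp

theorem hasDerivAt_weight_mul (hg : ∀ n x, HasDerivAt (g n) (g (n + 1) x) x) (x : ℝ) :
    HasDerivAt (fun x => (1 - x ^ 2) * g 0 x) ((1 - x ^ 2) * g 1 x - 2 * x * g 0 x) x := by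
  refine ((hasDerivAt_weight x).mul (hg 0 x)).congr_deriv ?_
  ring

theorem hasDerivAt_weight_mul_deriv (hg : ∀ n x, HasDerivAt (g n) (g (n + 1) x) x) (x : ℝ) :
    HasDerivAt (fun x => (1 - x ^ 2) * g 1 x - 2 * x * g 0 x)
      ((1 - x ^ 2) * g 2 x - 4 * x * g 1 x - 2 * g 0 x) x := by
  refine (((hasDerivAt_weight x).mul (hg 1 x)).sub
    (((hasDerivAt_id x).const_mul 2).mul (hg 0 x))).congr_deriv ?_
  simp
  ring

theorem hasDerivAt_weight_mul_deriv_two (hg : ∀ n x, HasDerivAt (g n) (g (n + 1) x) x) (x : ℝ) :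
    HasDerivAt (fun x => (1 - x ^ 2) * g 2 x - 4 * x * g 1 x - 2 * g 0 x)
      ((1 - x ^ 2) * g 3 x - 6 * x * g 2 x - 6 * g 1 x) x := by
  refine ((((hasDerivAt_weight x).mul (hg 2 x)).sub
    (((hasDerivAt_id x).const_mul 4).mul (hg 1 x))).sub ((hg 0 x).const_mul 2)).congr_deriv ?_
  simp
  ring

theorem hasDerivAt_weight_mul_deriv_three (hg : ∀ n x, HasDerivAt (g n) (g (n + 1) x) x) (x : ℝ) :
    HasDerivAt (fun x => (1 - x ^ 2) * g 3 x - 6 * x * g 2 x - 6 * g 1 x)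
      ((1 - x ^ 2) * g 4 x - 8 * x * g 3 x - 12 * g 2 x) x := by
  refine ((((hasDerivAt_weight x).mul (hg 3 x)).sub
    (((hasDerivAt_id x).const_mul 6).mul (hg 2 x))).sub ((hg 1 x).const_mul 6)).congr_deriv ?_
  simp
  ring

open intervalIntegral in
/-- The zero mode of a solution vanishes when `α ≠ 1`. -/
theorem integral_weight_mul_eq_zero (hα : α ≠ 1)
    (hg : ∀ n x, HasDerivAt (g n) (g (n + 1) x) x) (hl : g 0 (-1) = 0) (hr : g 0 1 = 0)
    (hE : ∀ x ∈ Set.Ioo (-1 : ℝ) 1,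
      α * ((1 - x ^ 2) * ((1 - x ^ 2) * g 4 x - 8 * x * g 3 x - 12 * g 2 x)) =
        4 * g 0 x * (α * ((1 - x ^ 2) * g 3 x - 6 * x * g 2 x - 6 * g 1 x) + 6)) :
    ∫ x in (-1 : ℝ)..1, (1 - x ^ 2) * g 0 x = 0 := by
  have hc : ∀ n, Continuous (g n) := fun n =>
    continuous_iff_continuousAt.2 fun x => (hg n x).continuousAt
  have h0 := hc 0
  have h1 := hc 1
  have h2 := hc 2
  have h3 := hc 3
  have key := integral_eq_sub_of_hasDerivAt_of_le (a := (-1 : ℝ)) (b := 1) (by norm_num)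
    (f := fun x => α * ((1 - x ^ 2) ^ 2 * ((1 - x ^ 2) * g 3 x - 6 * x * g 2 x - 6 * g 1 x)
        + 4 * x * (1 - x ^ 2) * ((1 - x ^ 2) * g 2 x - 4 * x * g 1 x - 2 * g 0 x)
        + (12 * x ^ 2 - 4) * ((1 - x ^ 2) * g 1 x - 2 * x * g 0 x)
        - 24 * x * ((1 - x ^ 2) * g 0 x))
      - 4 * α * ((1 - x ^ 2) * g 0 x * ((1 - x ^ 2) * g 2 x - 4 * x * g 1 x - 2 * g 0 x)
        - ((1 - x ^ 2) * g 1 x - 2 * x * g 0 x) ^ 2 / 2))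
    (f' := fun x => 24 * (1 - α) * ((1 - x ^ 2) * g 0 x)) (by fun_prop) ?_
    ((by fun_prop : Continuous _).intervalIntegrable _ _)
  · rw [integral_const_mul] at key
    simp only [hl, hr] at key
    norm_num at key
    exact key.resolve_left (sub_ne_zero.2 hα.symm)
  · intro x hx
    have d0 := hasDerivAt_weight_mul hg x
    have d1 := hasDerivAt_weight_mul_deriv hg x
    have d2 := hasDerivAt_weight_mul_deriv_two hg x
    have d3 := hasDerivAt_weight_mul_deriv_three hg x
    have hw := hasDerivAt_weight x
    have hid := hasDerivAt_id x
    have := ((((((hw.pow 2).mul d3).add (((hid.const_mul 4).mul hw).mul d2)).add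
      ((((hid.pow 2).const_mul 12).sub_const 4).mul d1)).sub
      ((hid.const_mul 24).mul d0)).const_mul α).sub
      (((d0.mul d2).sub ((d1.pow 2).div_const 2)).const_mul (4 * α))
    refine this.congr_deriv ?_
    simp
    linear_combination (1 - x ^ 2) * hE x hx

open intervalIntegral in
/-- The energy estimate obtained by testing the equation with `(1 - x ^ 2) * g 0` and using
`g 1 ≤ 1 / α`. -/
theorem integral_energy_le (hα : 0 < α)
    (hg : ∀ n x, HasDerivAt (g n) (g (n + 1) x) x) (hl : g 0 (-1) = 0) (hr : g 0 1 = 0)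
    (hb : ∀ x ∈ Set.Ioo (-1 : ℝ) 1, α * g 1 x ≤ 1)
    (hE : ∀ x ∈ Set.Ioo (-1 : ℝ) 1,
      α * ((1 - x ^ 2) * ((1 - x ^ 2) * g 4 x - 8 * x * g 3 x - 12 * g 2 x)) =
        4 * g 0 x * (α * ((1 - x ^ 2) * g 3 x - 6 * x * g 2 x - 6 * g 1 x) + 6)) :
    (16 * α - 4) * ∫ x in (-1 : ℝ)..1, (1 - x ^ 2) ^ 2 * g 1 x ^ 2 ≤
      (4 * α + 24) * ∫ x in (-1 : ℝ)..1, (1 - x ^ 2) * g 0 x ^ 2 := by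
  have hc : ∀ n, Continuous (g n) := fun n =>
    continuous_iff_continuousAt.2 fun x => (hg n x).continuousAt
  have h0 := hc 0
  have h1 := hc 1
  have h2 := hc 2
  have h3 := hc 3
  have hd : ∀ x, HasDerivAt (fun x =>
      -α * ((1 - x ^ 2) * ((1 - x ^ 2) * g 0 x)
          * ((1 - x ^ 2) * g 3 x - 6 * x * g 2 x - 6 * g 1 x)
        - ((1 - x ^ 2) * ((1 - x ^ 2) * g 1 x - 2 * x * g 0 x)
          - 2 * x * ((1 - x ^ 2) * g 0 x)) * ((1 - x ^ 2) * g 2 x - 4 * x * g 1 x - 2 * g 0 x)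
        - 2 * x * ((1 - x ^ 2) * g 1 x - 2 * x * g 0 x) ^ 2
        - 2 * ((1 - x ^ 2) * g 0 x) * ((1 - x ^ 2) * g 1 x - 2 * x * g 0 x))
      + 4 * α * ((1 - x ^ 2) * g 0 x ^ 2 * ((1 - x ^ 2) * g 2 x - 4 * x * g 1 x - 2 * g 0 x)
        - (1 - x ^ 2) ^ 2 * g 0 x * g 1 x ^ 2 + 2 * x * (1 - x ^ 2) * g 0 x ^ 2 * g 1 x
        + (2 / 3 - 2 * x ^ 2) * g 0 x ^ 3)
      + 32 * α * (x * (1 - x ^ 2) * g 0 x ^ 2)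
      + 12 * α * ((1 - x ^ 2) * g 0 x * ((1 - x ^ 2) * g 1 x - 2 * x * g 0 x)))
      (-α * ((1 - x ^ 2) * ((1 - x ^ 2) * g 0 x)
          * ((1 - x ^ 2) * g 4 x - 8 * x * g 3 x - 12 * g 2 x)
        - (1 - x ^ 2) * ((1 - x ^ 2) * g 2 x - 4 * x * g 1 x - 2 * g 0 x) ^ 2
        - 4 * ((1 - x ^ 2) * g 1 x - 2 * x * g 0 x) ^ 2)
      + 4 * α * ((1 - x ^ 2) * g 0 x ^ 2 * ((1 - x ^ 2) * g 3 x - 6 * x * g 2 x - 6 * g 1 x)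
        - (1 - x ^ 2) ^ 2 * g 1 x ^ 3)
      - 16 * α * (((1 - x ^ 2) * g 1 x - 2 * x * g 0 x) ^ 2 - (1 - x ^ 2) ^ 2 * g 1 x ^ 2
        - 2 * (1 - x ^ 2) * g 0 x ^ 2)
      + 12 * α * ((1 - x ^ 2) * g 0 x * ((1 - x ^ 2) * g 2 x - 4 * x * g 1 x - 2 * g 0 x)
        + ((1 - x ^ 2) * g 1 x - 2 * x * g 0 x) ^ 2)) x := by
    intro x
    have d0 := hasDerivAt_weight_mul hg x
    have d1 := hasDerivAt_weight_mul_deriv hg x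
    have d2 := hasDerivAt_weight_mul_deriv_two hg x
    have d3 := hasDerivAt_weight_mul_deriv_three hg x
    have hw := hasDerivAt_weight x
    have hid := hasDerivAt_id x
    have dQ := ((((hw.mul d0).mul d3).sub
      (((hw.mul d1).sub ((hid.const_mul 2).mul d0)).mul d2)).sub
      ((hid.const_mul 2).mul (d1.pow 2))).sub ((d0.const_mul 2).mul d1)
    have dS := ((((hw.mul ((hg 0 x).pow 2)).mul d2).sub
      (((hw.pow 2).mul (hg 0 x)).mul ((hg 1 x).pow 2))).add
      ((((hid.const_mul 2).mul hw).mul ((hg 0 x).pow 2)).mul (hg 1 x))).add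
      ((((hid.pow 2).const_mul 2).const_sub (2 / 3)).mul ((hg 0 x).pow 3))
    have := (((dQ.const_mul (-α)).add (dS.const_mul (4 * α))).add
      (((hid.mul hw).mul ((hg 0 x).pow 2)).const_mul (32 * α))).add
      ((d0.mul d1).const_mul (12 * α))
    refine this.congr_deriv ?_
    simp
    ring
  have key := integral_le_sub_of_hasDeriv_right_of_le (a := (-1 : ℝ)) (b := 1)
    (φ := fun x => (16 * α - 4) * ((1 - x ^ 2) ^ 2 * g 1 x ^ 2)
      - (4 * α + 24) * ((1 - x ^ 2) * g 0 x ^ 2))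
    (by norm_num) (fun x _ => (hd x).continuousAt.continuousWithinAt)
    (fun x _ => (hd x).hasDerivWithinAt)
    (by fun_prop : Continuous _).continuousOn.integrableOn_Icc ?_
  · rw [integral_sub ((by fun_prop : Continuous _).intervalIntegrable _ _)
      ((by fun_prop : Continuous _).intervalIntegrable _ _), integral_const_mul,
      integral_const_mul] at key
    simp only [hl, hr] at key
    norm_num at key
    exact key
  · intro x hx
    have hw : 0 ≤ 1 - x ^ 2 := by nlinarith [hx.1, hx.2]
    have hcube : 0 ≤ ((1 - x ^ 2) * g 1 x) ^ 2 * (1 - α * g 1 x) :=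
      mul_nonneg (sq_nonneg _) (sub_nonneg.2 (hb x hx))
    have hgap : 0 ≤ α * ((1 - x ^ 2) *
        ((1 - x ^ 2) * g 2 x - 4 * x * g 1 x - 2 * g 0 x + 6 * g 0 x) ^ 2) := by positivity
    rw [← sub_nonneg]
    have h := add_nonneg hgap (mul_nonneg (by norm_num : (0 : ℝ) ≤ 4) hcube)
    refine h.trans_eq ?_
    linear_combination (1 - x ^ 2) * g 0 x * hE x hx

end EulerLagrange

/-- Corollary 3.4: for `2/3 < α < 1` any smooth axially symmetric solution of the
constant `Q`-curvature type equation on `S⁴` must be constant. -/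
theorem axially_symmetric_solution_constant (α : ℝ) (hα : 2 / 3 < α) (hα1 : α < 1)
    (u : ℝ → ℝ) (hu : ContDiff ℝ (⊤ : ℕ∞) u)
    (hode : ∀ x ∈ Set.Ioo (-1 : ℝ) 1,
      α * iteratedDeriv 3 (fun y : ℝ => (1 - y ^ 2) ^ 2 * deriv u y) x
        + 6 - 8 * Real.exp (4 * u x)
            / (∫ y in (-1 : ℝ)..1, (1 - y ^ 2) * Real.exp (4 * u y)) = 0) :
    ∀ x ∈ Set.Icc (-1 : ℝ) 1, ∀ y ∈ Set.Icc (-1 : ℝ) 1, u x = u y := by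
  have hα0 : 0 < α := by linarith
  have hw : ∀ x ∈ Set.Ioo (-1 : ℝ) 1, 0 < 1 - x ^ 2 := fun x hx => by nlinarith [hx.1, hx.2]
  have hw' : ∀ x ∈ Set.Icc (-1 : ℝ) 1, 0 ≤ 1 - x ^ 2 := fun x hx => by nlinarith [hx.1, hx.2]
  have hud : Differentiable ℝ u := hu.differentiable (by simp)
  have hu' : ContDiff ℝ (⊤ : ℕ∞) (deriv u) := (contDiff_infty_iff_deriv.1 hu).2
  have hG : ContDiff ℝ (⊤ : ℕ∞) fun y : ℝ => (1 - y ^ 2) * deriv u y := by fun_prop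
  obtain ⟨g, hg0, hg⟩ : ∃ g : ℕ → ℝ → ℝ, (∀ x, g 0 x = (1 - x ^ 2) * deriv u x) ∧
      ∀ n x, HasDerivAt (g n) (g (n + 1) x) x := by
    refine ⟨fun n => iteratedDeriv n fun y : ℝ => (1 - y ^ 2) * deriv u y, fun x => by simp,
      fun n x => ?_⟩
    have := (hG.differentiable_iteratedDeriv n (by exact_mod_cast ENat.natCast_lt_top n)) x
    simpa [iteratedDeriv_succ] using this.hasDerivAt
  have hl : g 0 (-1) = 0 := by simp [hg0]
  have hr : g 0 1 = 0 := by simp [hg0]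
  have d0 := hasDerivAt_weight_mul hg
  have d1 := hasDerivAt_weight_mul_deriv hg
  have d2 := hasDerivAt_weight_mul_deriv_two hg
  have d3 := hasDerivAt_weight_mul_deriv_three hg
  have hthird : iteratedDeriv 3 (fun y : ℝ => (1 - y ^ 2) ^ 2 * deriv u y) =
      fun x => (1 - x ^ 2) * g 3 x - 6 * x * g 2 x - 6 * g 1 x := by
    have hF : (fun y : ℝ => (1 - y ^ 2) ^ 2 * deriv u y) = fun x => (1 - x ^ 2) * g 0 x := by
      funext x
      rw [hg0]
      ring
    rw [hF, iteratedDeriv_succ', funext fun x => (d0 x).deriv, iteratedDeriv_succ',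
      funext fun x => (d1 x).deriv, iteratedDeriv_one, funext fun x => (d2 x).deriv]
  have hγ : 0 ≤ ∫ y in (-1 : ℝ)..1, (1 - y ^ 2) * Real.exp (4 * u y) :=
    intervalIntegral.integral_nonneg (by norm_num) fun x hx =>
      mul_nonneg (hw' x hx) (Real.exp_pos _).le
  rw [hthird] at hode
  generalize (∫ y in (-1 : ℝ)..1, (1 - y ^ 2) * Real.exp (4 * u y)) = γ at hγ hode
  have hE : ∀ x ∈ Set.Ioo (-1 : ℝ) 1,
      α * ((1 - x ^ 2) * ((1 - x ^ 2) * g 4 x - 8 * x * g 3 x - 12 * g 2 x)) =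
        4 * g 0 x * (α * ((1 - x ^ 2) * g 3 x - 6 * x * g 2 x - 6 * g 1 x) + 6) := by
    intro x hx
    have hexp := (((((hud x).hasDerivAt.const_mul 4).exp).const_mul 8).div_const γ)
    have hzero := (((d3 x).const_mul α).add_const 6).sub hexp
    have hloc := hzero.congr_of_eventuallyEq (f₁ := fun _ => 0)
      (Filter.eventually_of_mem (isOpen_Ioo.mem_nhds hx) fun y hy => (hode y hy).symm)
    have hder := hloc.unique (hasDerivAt_const x 0)
    have hx0 := hode x hx
    rw [hg0]
    linear_combination (1 - x ^ 2) * hder - 4 * (1 - x ^ 2) * deriv u x * hx0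
  have hb : ∀ x ∈ Set.Ioo (-1 : ℝ) 1, α * g 1 x ≤ 1 := by
    intro x hx
    have hid := hasDerivAt_id (𝕜 := ℝ)
    have h := deriv_mul_add_nonpos_of_third_deriv_nonneg
      (k₀ := fun x => α * ((1 - x ^ 2) * g 0 x) + (x ^ 3 - x))
      (k₁ := fun x => α * ((1 - x ^ 2) * g 1 x - 2 * x * g 0 x) + (3 * x ^ 2 - 1))
      (k₂ := fun x => α * ((1 - x ^ 2) * g 2 x - 4 * x * g 1 x - 2 * g 0 x) + 6 * x)
      (k₃ := fun x => α * ((1 - x ^ 2) * g 3 x - 6 * x * g 2 x - 6 * g 1 x) + 6)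
      (fun x => (((d0 x).const_mul α).add (((hid x).pow 3).sub (hid x))).congr_deriv (by simp))
      (fun x => (((d1 x).const_mul α).add
        ((((hid x).pow 2).const_mul 3).sub_const 1)).congr_deriv (by simp; ring))
      (fun x => (((d2 x).const_mul α).add ((hid x).const_mul 6)).congr_deriv (by simp))
      (fun x hx => by
        have := div_nonneg (by positivity : 0 ≤ 8 * Real.exp (4 * u x)) hγ
        linarith [hode x hx])
      (by norm_num) (by norm_num) (Set.Ioo_subset_Icc_self hx)
    have hpos := pow_pos (hw x hx) 2
    have : (1 - x ^ 2) ^ 2 * (α * g 1 x - 1) ≤ 0 := by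
      refine le_of_eq_of_le ?_ h
      ring
    nlinarith
  have hc0 : Continuous (g 0) := continuous_iff_continuousAt.2 fun x => (hg 0 x).continuousAt
  have hc1 : Continuous (g 1) := continuous_iff_continuousAt.2 fun x => (hg 1 x).continuousAt
  have hgap := four_mul_integral_le_of_integral_eq_zero (hg 0) hc1
    (integral_weight_mul_eq_zero hα1.ne hg hl hr hE)
  have henergy := integral_energy_le hα0 hg hl hr hb hE
  have hle : ∫ x in (-1 : ℝ)..1, (1 - x ^ 2) * g 0 x ^ 2 ≤ 0 := by nlinarith
  have hzero : ∀ x ∈ Set.Ioo (-1 : ℝ) 1, deriv u x = 0 := by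
    intro x hx
    by_contra hne
    refine hle.not_gt (intervalIntegral.integral_pos (by norm_num) (by fun_prop)
      (fun y hy => mul_nonneg (hw' y (Set.Ioc_subset_Icc_self hy)) (sq_nonneg _))
      ⟨x, Set.Ioo_subset_Icc_self hx, ?_⟩)
    have hpos := hw x hx
    rw [hg0]
    positivity
  have hconst : ∀ x ∈ Set.Icc (-1 : ℝ) 1, u x = u (-1) := by
    have hclosed : Set.EqOn (deriv u) 0 (Set.Icc (-1) 1) := by
      rw [← closure_Ioo (by norm_num : (-1 : ℝ) ≠ 1)]
      exact Set.EqOn.closure hzero hu'.continuous continuous_const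
    refine constant_of_has_deriv_right_zero hud.continuous.continuousOn fun x hx => ?_
    exact ((hud x).hasDerivAt.congr_deriv
      (hclosed (Set.Ico_subset_Icc_self hx))).hasDerivWithinAt
  intro x hx y hy
  rw [hconst x hx, hconst y hy]
end

section
/- Let α > 0 with α ≠ 1 and let u ∈ C^∞(S^4) solve α P_4 u + 6(1 - e^{4u}) = 0 with ∫_{S^4} e^{4u} dw = 1. Then for each coordinate function ξ_i, i = 1,…,5, one has ∫_{S^4} u ξ_i dw = 0 and ∫_{S^4} e^{4u} ξ_i dw = 0. -/
open MeasureTheory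

/-- Degree-zero homogeneous extension of a function on the unit sphere of `ℝ⁵`. -/
noncomputable def homExt (u : EuclideanSpace ℝ (Fin 5) → ℝ) :
    EuclideanSpace ℝ (Fin 5) → ℝ :=
  fun x => u (‖x‖⁻¹ • x)

/-- Euclidean Laplacian on `ℝ⁵`, as the trace of the second derivative. -/
noncomputable def eucLap (f : EuclideanSpace ℝ (Fin 5) → ℝ) :
    EuclideanSpace ℝ (Fin 5) → ℝ :=
  fun x => ∑ i : Fin 5,
    iteratedFDeriv ℝ 2 f x ![EuclideanSpace.single i 1, EuclideanSpace.single i 1]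

/-- The Laplace–Beltrami operator of `S⁴` computed via the homogeneous extension. -/
noncomputable def sphereLap (u : EuclideanSpace ℝ (Fin 5) → ℝ) :
    EuclideanSpace ℝ (Fin 5) → ℝ :=
  eucLap (homExt u)

/-- The Paneitz operator `P₄ = Δ² - 2Δ` on `S⁴`. -/
noncomputable def paneitz (u : EuclideanSpace ℝ (Fin 5) → ℝ) :
    EuclideanSpace ℝ (Fin 5) → ℝ :=
  fun x => sphereLap (sphereLap u) x - 2 * sphereLap u x

namespace PaneitzSphere

open Metric Set Filter Topology
open scoped ContDiff NNReal

/-- Five-dimensional Euclidean space. -/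
abbrev E5 : Type := EuclideanSpace ℝ (Fin 5)

/-- The unit sphere `S⁴`. -/
abbrev S4 : Set E5 := sphere (0 : E5) 1

/-- The standard basis vectors of `ℝ⁵`. -/
noncomputable abbrev stdVec (k : Fin 5) : E5 := EuclideanSpace.single k 1

/-- The partial derivative in the direction of the `k`-th coordinate. -/
noncomputable def pd (k : Fin 5) (f : E5 → ℝ) : E5 → ℝ := fun x => fderiv ℝ f x (stdVec k)

/-- The four-dimensional Hausdorff measure on `S⁴`. -/
noncomputable abbrev surf : Measure E5 := (μH[4] : Measure E5).restrict S4

/-! ### Finiteness of the surface measure -/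

/-- The parametrization of a face of the boundary of the cube `[-1, 1]⁵`, the `k`-th coordinate
being `s`. -/
noncomputable def cubeFace (k : Fin 5) (s : ℝ) (w : Fin 4 → ℝ) : E5 :=
  WithLp.toLp 2 (k.insertNth s w)

lemma contDiff_cubeFace (k : Fin 5) (s : ℝ) : ContDiff ℝ 1 (cubeFace k s) := by
  rw [contDiff_euclidean]
  intro i
  refine Fin.succAboveCases k ?_ (fun j => ?_) i
  · simpa [cubeFace] using contDiff_const
  · simpa [cubeFace] using contDiff_apply ℝ ℝ j

lemma hausdorffMeasure_normalized_cubeFace_lt_top (k : Fin 5) {s : ℝ} (hs : s ≠ 0) :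
    μH[4] ((fun w => ‖cubeFace k s w‖⁻¹ • cubeFace k s w) '' closedBall 0 1) < ⊤ := by
  have hne : ∀ w, cubeFace k s w ≠ 0 := fun w h => hs (by
    have := congrArg (fun x : E5 => x k) h
    simpa [cubeFace] using this)
  have hc : ContDiff ℝ 1 (fun w => ‖cubeFace k s w‖⁻¹ • cubeFace k s w) :=
    (((contDiff_cubeFace k s).norm ℝ hne).inv fun w => norm_ne_zero_iff.2 (hne w)).smul
      (contDiff_cubeFace k s)
  obtain ⟨K, hK⟩ := hc.contDiffOn.exists_lipschitzOnWith one_ne_zero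
    (convex_closedBall (0 : Fin 4 → ℝ) 1) (isCompact_closedBall _ _)
  refine (hK.hausdorffMeasure_image_le (by norm_num : (0 : ℝ) ≤ 4)).trans_lt ?_
  have h4 : (μH[4] : Measure (Fin 4 → ℝ)) = volume := by
    simpa using hausdorffMeasure_pi_real (ι := Fin 4)
  rw [h4]
  exact ENNReal.mul_lt_top (by simp) (isCompact_closedBall _ _).measure_lt_top

lemma sphere_subset_normalized_cubeFace :
    S4 ⊆ ⋃ k : Fin 5, ⋃ s ∈ ({1, -1} : Set ℝ),
      (fun w => ‖cubeFace k s w‖⁻¹ • cubeFace k s w) '' closedBall 0 1 := by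
  intro x hx
  obtain ⟨k, hk⟩ := Finite.exists_max (fun i => |x i|)
  have hnorm : ‖x‖ = 1 := by simpa using hx
  have hxk : x k ≠ 0 := by
    intro h0
    have : x = 0 := by
      ext i
      have := hk i
      simpa [h0] using this
    simp [this] at hnorm
  have hpos : 0 < |x k| := abs_pos.2 hxk
  have hface : cubeFace k (x k / |x k|) (fun j => x (k.succAbove j) / |x k|) = |x k|⁻¹ • x := by
    ext i
    refine Fin.succAboveCases k ?_ (fun j => ?_) i <;> simp [cubeFace] <;> ring
  simp only [mem_iUnion]
  refine ⟨k, x k / |x k|, ?_, fun j => x (k.succAbove j) / |x k|, ?_, ?_⟩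
  · rcases lt_or_gt_of_ne hxk with h | h
    · simp [abs_of_neg h, div_neg, div_self hxk]
    · simp [abs_of_pos h, div_self hxk]
  · rw [mem_closedBall_zero_iff, pi_norm_le_iff_of_nonneg zero_le_one]
    intro j
    rw [Real.norm_eq_abs, abs_div, abs_abs, div_le_one hpos]
    exact hk _
  · simp only [hface]
    rw [norm_smul, hnorm, smul_smul, norm_inv, Real.norm_eq_abs, abs_abs]
    simp [hpos.ne']

lemma hausdorffMeasure_sphere_lt_top : (μH[4] : Measure E5) S4 < ⊤ := by
  refine (measure_mono sphere_subset_normalized_cubeFace).trans_lt ?_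
  refine (measure_iUnion_fintype_le _ _).trans_lt (ENNReal.sum_lt_top.2 fun k _ => ?_)
  refine measure_biUnion_lt_top (Set.toFinite _) fun s hs => ?_
  refine hausdorffMeasure_normalized_cubeFace_lt_top k ?_
  rcases hs with rfl | rfl <;> norm_num

instance isFiniteMeasure_surf : IsFiniteMeasure surf :=
  ⟨by simpa using hausdorffMeasure_sphere_lt_top⟩

/-! ### Rotations -/

/-- The rotation by the angle `t` in the plane of the coordinates `j` and `k`. -/
noncomputable def rot (j k : Fin 5) (t : ℝ) : E5 →ₗ[ℝ] E5 where
  toFun x := x + ((Real.cos t - 1) * x j - Real.sin t * x k) • stdVec j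
    + ((Real.cos t - 1) * x k + Real.sin t * x j) • stdVec k
  map_add' x y := by
    simp only [PiLp.add_apply]
    module
  map_smul' c x := by
    simp only [PiLp.smul_apply, smul_eq_mul, RingHom.id_apply]
    module

lemma rot_apply (j k : Fin 5) (t : ℝ) (x : E5) :
    rot j k t x = x + ((Real.cos t - 1) * x j - Real.sin t * x k) • stdVec j
      + ((Real.cos t - 1) * x k + Real.sin t * x j) • stdVec k := rfl

lemma norm_rot {j k : Fin 5} (h : j ≠ k) (t : ℝ) (x : E5) : ‖rot j k t x‖ = ‖x‖ := by
  rw [← sq_eq_sq₀ (norm_nonneg _) (norm_nonneg _), rot_apply, norm_add_sq_real, norm_add_sq_real,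
    inner_add_left]
  simp only [inner_smul_left, inner_smul_right, EuclideanSpace.inner_single_right, norm_smul,
    PiLp.norm_single, PiLp.single_apply, mul_pow, Real.norm_eq_abs, sq_abs]
  simp [h.symm]
  linear_combination (x j ^ 2 + x k ^ 2) * Real.sin_sq_add_cos_sq t

lemma measurePreserving_rot {j k : Fin 5} (h : j ≠ k) (t : ℝ) :
    MeasurePreserving (rot j k t) surf surf := by
  let e := (LinearIsometry.mk (rot j k t) (norm_rot h t)).toLinearIsometryEquiv rfl
  have hp : MeasurePreserving (rot j k t) (μH[4] : Measure E5) μH[4] :=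
    e.toIsometryEquiv.measurePreserving_hausdorffMeasure 4
  have hpre : rot j k t ⁻¹' S4 = S4 := by
    ext x
    simp [norm_rot h]
  simpa only [hpre] using hp.restrict_preimage (s := S4) isClosed_sphere.measurableSet

lemma hasDerivAt_rot {j k : Fin 5} (h : j ≠ k) (t : ℝ) (x : E5) :
    HasDerivAt (fun t => rot j k t x)
      ((rot j k t x) j • stdVec k - (rot j k t x) k • stdVec j) t := by
  simp only [rot_apply]
  have h1 := (((((Real.hasDerivAt_cos t).sub_const 1).mul_const (x j)).sub
    ((Real.hasDerivAt_sin t).mul_const (x k))).smul_const (stdVec j)).const_add x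
  have h2 := ((((Real.hasDerivAt_cos t).sub_const 1).mul_const (x k)).add
    ((Real.hasDerivAt_sin t).mul_const (x j))).smul_const (stdVec k)
  refine (h1.add h2).congr_deriv ?_
  simp [h, h.symm]
  module

/-- A smooth function on `ℝ⁵ ∖ {0}`. -/
abbrev SmoothOff (f : E5 → ℝ) : Prop := ContDiffOn ℝ ∞ f {0}ᶜ

lemma ne_zero_of_mem_sphere {x : E5} (hx : x ∈ S4) : x ≠ 0 := by
  rintro rfl
  simp at hx

lemma sphere_subset_compl_zero : S4 ⊆ ({0}ᶜ : Set E5) := fun _ hx => ne_zero_of_mem_sphere hx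

lemma SmoothOff.contDiffAt {f : E5 → ℝ} (hf : SmoothOff f) {x : E5} (hx : x ≠ 0) :
    ContDiffAt ℝ ∞ f x :=
  ContDiffOn.contDiffAt hf (isOpen_compl_singleton.mem_nhds hx)

lemma SmoothOff.differentiableAt {f : E5 → ℝ} (hf : SmoothOff f) {x : E5} (hx : x ≠ 0) :
    DifferentiableAt ℝ f x :=
  (hf.contDiffAt hx).differentiableAt (by simp)

lemma SmoothOff.pd {f : E5 → ℝ} (hf : SmoothOff f) (k : Fin 5) : SmoothOff (pd k f) :=
  (ContDiffOn.fderiv_of_isOpen hf isOpen_compl_singleton (m := ∞) (by simp)).clm_apply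
    contDiffOn_const

lemma smoothOff_coord (k : Fin 5) : SmoothOff (fun x => x k) :=
  (contDiff_piLp_apply 2).contDiffOn

lemma SmoothOff.integrable {f : E5 → ℝ} (hf : SmoothOff f) : Integrable f surf :=
  ((ContDiffOn.continuousOn hf).mono sphere_subset_compl_zero).integrableOn_of_subset_isCompact
    (isCompact_sphere _ _) isClosed_sphere.measurableSet Subset.rfl
    hausdorffMeasure_sphere_lt_top.ne

lemma ae_surf_mem : ∀ᵐ x ∂surf, x ∈ S4 :=
  ae_restrict_mem isClosed_sphere.measurableSet

lemma integral_surf_congr {f g : E5 → ℝ} (h : ∀ x ∈ S4, f x = g x) :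
    ∫ x, f x ∂surf = ∫ x, g x ∂surf :=
  setIntegral_congr_fun isClosed_sphere.measurableSet h

lemma integral_rot_comp {j k : Fin 5} (h : j ≠ k) (t : ℝ) {f : E5 → ℝ} (hf : SmoothOff f) :
    ∫ x, f (rot j k t x) ∂surf = ∫ x, f x ∂surf := by
  have hm := measurePreserving_rot h t
  have hi : AEStronglyMeasurable f (Measure.map (rot j k t) surf) := by
    rw [hm.map_eq]; exact hf.integrable.aestronglyMeasurable
  conv_rhs => rw [← hm.map_eq]
  exact (integral_map hm.measurable.aemeasurable hi).symm

/-- The infinitesimal generator of a rotation integrates to zero over the sphere. -/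
lemma integral_rotationField_eq_zero {f : E5 → ℝ} (hf : SmoothOff f) (j k : Fin 5) :
    ∫ x, (x j * pd k f x - x k * pd j f x) ∂surf = 0 := by
  rcases eq_or_ne j k with rfl | h
  · simp
  set L : E5 → ℝ := fun x => x j * pd k f x - x k * pd j f x with hL
  have hLs : SmoothOff L :=
    ((smoothOff_coord j).mul (hf.pd k)).sub ((smoothOff_coord k).mul (hf.pd j))
  obtain ⟨C, hC⟩ := (isCompact_sphere (0 : E5) 1).exists_bound_of_continuousOn
    ((ContDiffOn.continuousOn hLs).mono sphere_subset_compl_zero)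
  have hmem : ∀ t, ∀ x ∈ S4, rot j k t x ∈ S4 := fun t x hx => by
    simpa [norm_rot h] using hx
  have hcomp : ∀ t, Integrable (fun x => f (rot j k t x)) surf := fun t =>
    (measurePreserving_rot h t).integrable_comp_of_integrable hf.integrable
  have hLcomp : ∀ t, Integrable (fun x => L (rot j k t x)) surf := fun t =>
    (measurePreserving_rot h t).integrable_comp_of_integrable hLs.integrable
  have hder := (hasDerivAt_integral_of_dominated_loc_of_deriv_le (μ := surf) (x₀ := (0 : ℝ))
    (F := fun t x => f (rot j k t x)) (F' := fun t x => L (rot j k t x))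
    (bound := fun _ => C) univ_mem (Eventually.of_forall fun t => (hcomp t).aestronglyMeasurable)
    (hcomp 0) (hLcomp 0).aestronglyMeasurable
    (ae_surf_mem.mono fun x hx t _ => hC _ (hmem t x hx)) (integrable_const _)
    (ae_surf_mem.mono fun x hx t _ => by
      have hd := (hf.differentiableAt
        (ne_zero_of_mem_sphere (hmem t x hx))).hasFDerivAt.comp_hasDerivAt t (hasDerivAt_rot h t x)
      refine hd.congr_deriv ?_
      simp [hL, pd])).2
  simp only [integral_rot_comp h _ hf, integral_rot_comp h _ hLs] at hder
  exact hder.unique (hasDerivAt_const _ _)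

/-! ### Calculus of homogeneous functions -/

lemma pd_mul {f g : E5 → ℝ} (hf : SmoothOff f) (hg : SmoothOff g) (k : Fin 5) {x : E5}
    (hx : x ≠ 0) : pd k (fun y => f y * g y) x = f x * pd k g x + g x * pd k f x := by
  simp [pd, fderiv_fun_mul (hf.differentiableAt hx) (hg.differentiableAt hx)]

lemma pd_add {f g : E5 → ℝ} (hf : SmoothOff f) (hg : SmoothOff g) (k : Fin 5) {x : E5}
    (hx : x ≠ 0) : pd k (fun y => f y + g y) x = pd k f x + pd k g x := by
  simp [pd, fderiv_fun_add (hf.differentiableAt hx) (hg.differentiableAt hx)]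

lemma pd_sum {f : Fin 5 → E5 → ℝ} (hf : ∀ i, SmoothOff (f i)) (k : Fin 5) {x : E5}
    (hx : x ≠ 0) : pd k (fun y => ∑ i, f i y) x = ∑ i, pd k (f i) x := by
  simp [pd, fderiv_fun_sum fun i _ => (hf i).differentiableAt hx]

lemma fderiv_mul_left (c : ℝ) (f : E5 → ℝ) (x : E5) :
    fderiv ℝ (fun y => c * f y) x = c • fderiv ℝ f x :=
  congrFun (fderiv_const_smul_field c) x

lemma pd_const_mul (c : ℝ) (f : E5 → ℝ) (k : Fin 5) (x : E5) :
    pd k (fun y => c * f y) x = c * pd k f x := by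
  simp [pd, fderiv_mul_left]

lemma pd_congr {f g : E5 → ℝ} (h : ∀ x ≠ 0, f x = g x) (k : Fin 5) {x : E5} (hx : x ≠ 0) :
    pd k f x = pd k g x := by
  have : f =ᶠ[𝓝 x] g := by
    filter_upwards [isOpen_compl_singleton.mem_nhds hx] with y hy using h y hy
  rw [pd, pd, this.fderiv_eq]

lemma pd_coord (j k : Fin 5) (x : E5) : pd k (fun y => y j) x = if j = k then 1 else 0 := by
  have : (fun y : E5 => y j) = EuclideanSpace.proj (𝕜 := ℝ) j := rfl
  rw [pd, this, ContinuousLinearMap.fderiv]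
  simp [PiLp.single_apply]

lemma fderiv_pd {f : E5 → ℝ} (hf : SmoothOff f) (k : Fin 5) {x : E5} (hx : x ≠ 0) (w : E5) :
    fderiv ℝ (pd k f) x w = fderiv ℝ (fderiv ℝ f) x w (stdVec k) := by
  have hd : DifferentiableAt ℝ (fderiv ℝ f) x :=
    ((hf.contDiffAt hx).fderiv_right (m := 1) (by norm_cast)).differentiableAt one_ne_zero
  have : pd k f = fun y => fderiv ℝ f y (stdVec k) := rfl
  rw [this, fderiv_clm_apply hd (differentiableAt_const _)]
  simp

lemma fderiv_fderiv_comm {f : E5 → ℝ} (hf : SmoothOff f) {x : E5} (hx : x ≠ 0) (v w : E5) :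
    fderiv ℝ (fderiv ℝ f) x v w = fderiv ℝ (fderiv ℝ f) x w v :=
  (hf.contDiffAt hx).isSymmSndFDerivAt (by simp; norm_cast) v w

lemma pd_comm {f : E5 → ℝ} (hf : SmoothOff f) (j k : Fin 5) {x : E5} (hx : x ≠ 0) :
    pd j (pd k f) x = pd k (pd j f) x := by
  rw [pd, pd, fderiv_pd hf k hx, fderiv_pd hf j hx, fderiv_fderiv_comm hf hx]

lemma fderiv_apply_eq_sum (f : E5 → ℝ) (x w : E5) :
    fderiv ℝ f x w = ∑ j, w j * pd j f x := by
  have hw : w = ∑ j, w j • stdVec j := by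
    ext i
    simp [Pi.single_apply]
  conv_lhs => rw [hw]
  simp [pd]

/-- The Laplacian as the sum of the pure second partial derivatives. -/
noncomputable def lap (f : E5 → ℝ) : E5 → ℝ := fun x => ∑ i, pd i (pd i f) x

lemma SmoothOff.lap {f : E5 → ℝ} (hf : SmoothOff f) : SmoothOff (lap f) :=
  ContDiffOn.sum fun i _ => (hf.pd i).pd i

lemma eucLap_eq_lap {f : E5 → ℝ} (hf : SmoothOff f) {x : E5} (hx : x ≠ 0) :
    eucLap f x = lap f x := by
  refine Finset.sum_congr rfl fun i _ => ?_
  rw [iteratedFDeriv_two_apply, pd, fderiv_pd hf i hx]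
  rfl

lemma lap_congr {f g : E5 → ℝ} (h : ∀ x ≠ 0, f x = g x) {x : E5} (hx : x ≠ 0) :
    lap f x = lap g x :=
  Finset.sum_congr rfl fun i _ => pd_congr (fun _ hy => pd_congr h i hy) i hx

lemma lap_pd {f : E5 → ℝ} (hf : SmoothOff f) (k : Fin 5) {x : E5} (hx : x ≠ 0) :
    lap (pd k f) x = pd k (lap f) x := by
  unfold lap
  rw [pd_sum (fun i => (hf.pd i).pd i) k hx]
  refine Finset.sum_congr rfl fun i _ => ?_
  rw [pd_congr (fun y hy => pd_comm hf i k hy) i hx, pd_comm (hf.pd i) i k hx]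

lemma lap_mul {f g : E5 → ℝ} (hf : SmoothOff f) (hg : SmoothOff g) {x : E5} (hx : x ≠ 0) :
    lap (fun y => f y * g y) x
      = f x * lap g x + 2 * ∑ i, pd i f x * pd i g x + g x * lap f x := by
  simp only [lap, Finset.mul_sum, ← Finset.sum_add_distrib]
  refine Finset.sum_congr rfl fun i _ => ?_
  rw [pd_congr (fun y hy => pd_mul hf hg i hy) i hx,
    pd_add (hf.mul (hg.pd i)) (hg.mul (hf.pd i)) i hx, pd_mul hf (hg.pd i) i hx,
    pd_mul hg (hf.pd i) i hx]
  ring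

lemma lap_coord (k : Fin 5) (x : E5) : lap (fun y => y k) x = 0 := by
  have : ∀ i, pd i (fun y => y k) = fun _ => if k = i then 1 else 0 :=
    fun i => funext (pd_coord k i)
  simp [lap, this, pd]

lemma pd_comp_smul (f : E5 → ℝ) (t : ℝ) (k : Fin 5) (x : E5) :
    pd k (fun y => f (t • y)) x = t * pd k f (t • x) := by
  simp [pd, fderiv_comp_smul]

lemma lap_comp_smul (f : E5 → ℝ) (t : ℝ) (x : E5) :
    lap (fun y => f (t • y)) x = t ^ 2 * lap f (t • x) := by
  rw [lap, lap, Finset.mul_sum]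
  refine Finset.sum_congr rfl fun i _ => ?_
  have h1 : pd i (fun y => f (t • y)) = fun y => t * pd i f (t • y) :=
    funext (pd_comp_smul f t i)
  rw [h1, pd_const_mul, pd_comp_smul]
  ring

/-- A function, smooth on `ℝ⁵ ∖ {0}`, that satisfies Euler's relation of degree `d`. -/
structure EulerHom (d : ℝ) (f : E5 → ℝ) : Prop where
  smooth : SmoothOff f
  euler : ∀ x ≠ 0, fderiv ℝ f x x = d * f x

namespace EulerHom

variable {a b : ℝ} {f g : E5 → ℝ}

lemma sum_coord_mul_pd (hf : EulerHom a f) {x : E5} (hx : x ≠ 0) :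
    ∑ j, x j * pd j f x = a * f x := by
  rw [← fderiv_apply_eq_sum, hf.euler x hx]

lemma pd (hf : EulerHom a f) (k : Fin 5) : EulerHom (a - 1) (pd k f) := by
  refine ⟨hf.smooth.pd k, fun x hx => ?_⟩
  have h1 : PaneitzSphere.pd k (fun y => ∑ j, y j * PaneitzSphere.pd j f y) x
      = PaneitzSphere.pd k (fun y => a * f y) x :=
    pd_congr (fun y hy => hf.sum_coord_mul_pd hy) k hx
  rw [pd_sum (fun j => (smoothOff_coord j).mul (hf.smooth.pd j)) k hx, pd_const_mul] at h1
  simp only [pd_mul (smoothOff_coord _) (hf.smooth.pd _) k hx, pd_coord,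
    Finset.sum_add_distrib, pd_comm hf.smooth k _ hx] at h1
  rw [fderiv_apply_eq_sum]
  simp at h1
  linarith

lemma mul (hf : EulerHom a f) (hg : EulerHom b g) : EulerHom (a + b) (fun x => f x * g x) := by
  refine ⟨hf.smooth.mul hg.smooth, fun x hx => ?_⟩
  rw [fderiv_fun_mul (hf.smooth.differentiableAt hx) (hg.smooth.differentiableAt hx)]
  simp [hf.euler x hx, hg.euler x hx]
  ring

lemma sub (hf : EulerHom a f) (hg : EulerHom a g) : EulerHom a (fun x => f x - g x) := by
  refine ⟨hf.smooth.sub hg.smooth, fun x hx => ?_⟩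
  rw [fderiv_fun_sub (hf.smooth.differentiableAt hx) (hg.smooth.differentiableAt hx)]
  simp [hf.euler x hx, hg.euler x hx]
  ring

lemma const_mul (c : ℝ) (hf : EulerHom a f) : EulerHom a (fun x => c * f x) := by
  refine ⟨contDiffOn_const.mul hf.smooth, fun x hx => ?_⟩
  simp [fderiv_mul_left, hf.euler x hx]
  ring

lemma exp (hf : EulerHom 0 f) : EulerHom 0 (fun x => Real.exp (f x)) := by
  refine ⟨ContDiffOn.exp hf.smooth, fun x hx => ?_⟩
  rw [fderiv_exp (hf.smooth.differentiableAt hx)]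
  simp [hf.euler x hx]

lemma lap (hf : EulerHom a f) : EulerHom (a - 2) (lap f) := by
  refine ⟨hf.smooth.lap, fun x hx => ?_⟩
  have h : ∀ i, DifferentiableAt ℝ (PaneitzSphere.pd i (PaneitzSphere.pd i f)) x := fun i =>
    ((hf.smooth.pd i).pd i).differentiableAt hx
  have h' : fderiv ℝ (PaneitzSphere.lap f) x
      = ∑ i, fderiv ℝ (PaneitzSphere.pd i (PaneitzSphere.pd i f)) x :=
    fderiv_fun_sum fun i _ => h i
  rw [h', sum_apply, PaneitzSphere.lap, Finset.mul_sum]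
  refine Finset.sum_congr rfl fun i _ => ?_
  rw [((hf.pd i).pd i).euler x hx]
  ring

lemma coord (k : Fin 5) : EulerHom 1 (fun x => x k) := by
  refine ⟨smoothOff_coord k, fun x _ => ?_⟩
  rw [fderiv_apply_eq_sum]
  simp [pd_coord]

/-! ### Integration by parts on the sphere -/

lemma integral_pd (hf : EulerHom a f) (k : Fin 5) :
    ∫ x, PaneitzSphere.pd k f x ∂surf = (4 + a) * ∫ x, x k * f x ∂surf := by
  have hs : ∀ j, SmoothOff (fun x => x j * f x) := fun j => (smoothOff_coord j).mul hf.smooth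
  have hsum : ∫ x, ∑ j, (x j * PaneitzSphere.pd k (fun y => y j * f y) x
      - x k * PaneitzSphere.pd j (fun y => y j * f y) x) ∂surf = 0 := by
    rw [integral_finsetSum]
    · exact Finset.sum_eq_zero fun j _ => integral_rotationField_eq_zero (hs j) j k
    · exact fun j _ => SmoothOff.integrable (((smoothOff_coord j).mul ((hs j).pd k)).sub
        ((smoothOff_coord k).mul ((hs j).pd j)))
  have hpt : ∀ x ∈ S4, ∑ j, (x j * PaneitzSphere.pd k (fun y => y j * f y) x
      - x k * PaneitzSphere.pd j (fun y => y j * f y) x)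
      = PaneitzSphere.pd k f x - (4 + a) * (x k * f x) := by
    intro x hx
    have hx0 := ne_zero_of_mem_sphere hx
    have hr : ∑ j, x j ^ 2 = 1 := by
      rw [← EuclideanSpace.real_norm_sq_eq, mem_sphere_zero_iff_norm.1 hx, one_pow]
    have he := hf.sum_coord_mul_pd hx0
    simp only [pd_mul (smoothOff_coord _) hf.smooth _ hx0, pd_coord]
    have hδ : ∑ j, x j * (if j = k then 1 else 0) = x k := by simp
    simp only [Fin.sum_univ_five, if_true] at hr he hδ ⊢
    linear_combination PaneitzSphere.pd k f x * hr - x k * he + f x * hδ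
  rw [integral_surf_congr hpt, integral_sub (hf.smooth.pd k).integrable
    ((hs k).integrable.const_mul _), integral_const_mul] at hsum
  linarith

lemma integral_coord (k : Fin 5) : ∫ x, x k ∂surf = 0 := by
  have h1 : EulerHom 0 (fun _ => 1) := ⟨contDiffOn_const, by simp⟩
  simpa [PaneitzSphere.pd] using h1.integral_pd k

/-- Green's first identity for homogeneous functions on the sphere. -/
lemma integral_green (hf : EulerHom a f) (hg : EulerHom b g) :
    ∫ x, ∑ k, PaneitzSphere.pd k g x * PaneitzSphere.pd k f x ∂surf
      + ∫ x, g x * PaneitzSphere.lap f x ∂surf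
      = a * (3 + a + b) * ∫ x, f x * g x ∂surf := by
  have hgf : ∀ k, EulerHom (b + (a - 1)) (fun x => g x * PaneitzSphere.pd k f x) :=
    fun k => hg.mul (hf.pd k)
  have hc : ∀ k, SmoothOff (fun x => x k * (g x * PaneitzSphere.pd k f x)) :=
    fun k => (smoothOff_coord k).mul (hgf k).smooth
  have hB : SmoothOff (fun x => ∑ k, PaneitzSphere.pd k g x * PaneitzSphere.pd k f x) :=
    ContDiffOn.sum fun k _ => (hg.smooth.pd k).mul (hf.smooth.pd k)
  have hL : SmoothOff (fun x => g x * PaneitzSphere.lap f x) := hg.smooth.mul hf.smooth.lap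
  have hsum : ∑ k, ∫ x, PaneitzSphere.pd k (fun y => g y * PaneitzSphere.pd k f y) x ∂surf
      = ∑ k, (4 + (b + (a - 1))) * ∫ x, x k * (g x * PaneitzSphere.pd k f x) ∂surf :=
    Finset.sum_congr rfl fun k _ => (hgf k).integral_pd k
  rw [← Finset.mul_sum, ← integral_finsetSum _ fun k _ => ((hgf k).smooth.pd k).integrable,
    ← integral_finsetSum _ fun k _ => (hc k).integrable] at hsum
  have h1 : ∀ x ∈ S4, ∑ k, PaneitzSphere.pd k (fun y => g y * PaneitzSphere.pd k f y) x
      = ∑ k, PaneitzSphere.pd k g x * PaneitzSphere.pd k f x + g x * PaneitzSphere.lap f x := by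
    intro x hx
    rw [PaneitzSphere.lap, Finset.mul_sum, ← Finset.sum_add_distrib]
    refine Finset.sum_congr rfl fun k _ => ?_
    rw [pd_mul hg.smooth (hf.smooth.pd k) k (ne_zero_of_mem_sphere hx)]
    ring
  have h2 : ∀ x ∈ S4, ∑ k, x k * (g x * PaneitzSphere.pd k f x) = a * (f x * g x) := by
    intro x hx
    rw [← mul_assoc, ← hf.sum_coord_mul_pd (ne_zero_of_mem_sphere hx), Finset.sum_mul]
    exact Finset.sum_congr rfl fun k _ => by ring
  rw [integral_surf_congr h1, integral_surf_congr h2, integral_add hB.integrable hL.integrable,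
    integral_const_mul] at hsum
  rw [hsum]
  ring

/-- Green's second identity for homogeneous functions on the sphere. -/
lemma integral_mul_lap (hf : EulerHom a f) (hg : EulerHom b g) :
    ∫ x, g x * PaneitzSphere.lap f x ∂surf
      = ∫ x, f x * PaneitzSphere.lap g x ∂surf
        + (a - b) * (3 + a + b) * ∫ x, f x * g x ∂surf := by
  have h1 := hf.integral_green hg
  have h2 := hg.integral_green hf
  simp only [mul_comm (PaneitzSphere.pd _ f _)] at h2
  simp only [mul_comm (g _) (f _)] at h2
  linear_combination h1 - h2

/-- The bi-Laplacian of a function of degree zero, which on the sphere is the Paneitz operator, is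
orthogonal to the derivatives along the conformal gradient fields. -/
lemma integral_bilap_mul_pd (hf : EulerHom 0 f) (k : Fin 5) :
    ∫ x, PaneitzSphere.pd k f x * PaneitzSphere.lap (PaneitzSphere.lap f) x ∂surf = 0 := by
  have h1 := hf.lap.integral_mul_lap (hf.pd k)
  have h2 := (hf.lap.mul hf.lap).integral_pd k
  have h3 : ∀ x ∈ S4, PaneitzSphere.lap f x * PaneitzSphere.lap (PaneitzSphere.pd k f) x
      = 1 / 2 * PaneitzSphere.pd k
        (fun y => PaneitzSphere.lap f y * PaneitzSphere.lap f y) x := by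
    intro x hx
    have hx0 := ne_zero_of_mem_sphere hx
    rw [pd_mul hf.smooth.lap hf.smooth.lap k hx0, lap_pd hf.smooth k hx0]
    ring
  rw [h1, integral_surf_congr h3, integral_const_mul, h2]
  ring

/-- The coordinate functions are eigenfunctions of the Paneitz operator, with eigenvalue `24`. -/
lemma integral_coord_mul_bilap (hf : EulerHom 0 f) (k : Fin 5) :
    ∫ x, x k * PaneitzSphere.lap (PaneitzSphere.lap f) x ∂surf = 24 * ∫ x, f x * x k ∂surf := by
  have h1 := hf.integral_mul_lap (coord k)
  have h2 := hf.lap.integral_mul_lap (coord k)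
  simp only [lap_coord, mul_zero, integral_zero, zero_add] at h1 h2
  simp only [mul_comm (PaneitzSphere.lap f _)] at h2
  rw [h2, h1]
  ring

end EulerHom

/-! ### The Paneitz operator in terms of the homogeneous extension -/

lemma homExt_smul (u : E5 → ℝ) {t : ℝ} (ht : 0 < t) (x : E5) :
    homExt u (t • x) = homExt u x := by
  have : (t * ‖x‖)⁻¹ * t = ‖x‖⁻¹ := by
    rw [mul_inv, mul_right_comm, inv_mul_cancel₀ ht.ne', one_mul]
  rw [homExt, homExt, norm_smul, Real.norm_eq_abs, abs_of_pos ht, smul_smul, this]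

lemma homExt_of_mem_sphere (u : E5 → ℝ) {x : E5} (hx : x ∈ S4) : homExt u x = u x := by
  simp [homExt, mem_sphere_zero_iff_norm.1 hx]

lemma eulerHom_homExt {u : E5 → ℝ} (hu : SmoothOff (homExt u)) : EulerHom 0 (homExt u) := by
  refine ⟨hu, fun x hx => ?_⟩
  have h1 : HasDerivAt (fun t : ℝ => t • x) x 1 := by
    simpa using (hasDerivAt_id (1 : ℝ)).smul_const x
  have hd : HasFDerivAt (homExt u) (fderiv ℝ (homExt u) x) ((1 : ℝ) • x) := by
    simpa using (hu.differentiableAt hx).hasFDerivAt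
  have h2 : HasDerivAt (fun t : ℝ => homExt u (t • x)) 0 1 := by
    refine (hasDerivAt_const (1 : ℝ) (homExt u x)).congr_of_eventuallyEq ?_
    filter_upwards [lt_mem_nhds one_pos] with t ht using homExt_smul u ht x
  rw [zero_mul]
  have h3 : HasDerivAt (fun t : ℝ => homExt u (t • x)) (fderiv ℝ (homExt u) x x) 1 :=
    HasFDerivAt.comp_hasDerivAt (l := homExt u) (1 : ℝ) hd h1
  exact h3.unique h2

lemma homExt_sphereLap {u : E5 → ℝ} (hu : SmoothOff (homExt u)) {x : E5} (hx : x ≠ 0) :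
    homExt (sphereLap u) x = (∑ j, x j * x j) * lap (homExt u) x := by
  have hn : 0 < ‖x‖⁻¹ := inv_pos.2 (norm_pos_iff.2 hx)
  have h1 : (fun y => homExt u (‖x‖⁻¹ • y)) = homExt u := funext (homExt_smul u hn)
  have h2 := lap_comp_smul (homExt u) ‖x‖⁻¹ x
  have h3 : ∑ j, x j * x j = ‖x‖ ^ 2 := by
    rw [EuclideanSpace.real_norm_sq_eq]
    simp only [sq]
  have h4 : ‖x‖ ≠ 0 := norm_ne_zero_iff.2 hx
  rw [h1] at h2
  rw [homExt, sphereLap, eucLap_eq_lap hu (smul_ne_zero hn.ne' hx), h2, h3]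
  field_simp

lemma pd_sum_sq (i : Fin 5) {x : E5} (hx : x ≠ 0) :
    pd i (fun y => ∑ j, y j * y j) x = 2 * x i := by
  rw [pd_sum (fun j => (smoothOff_coord j).mul (smoothOff_coord j)) i hx]
  simp only [pd_mul (smoothOff_coord _) (smoothOff_coord _) i hx, pd_coord,
    Finset.sum_add_distrib]
  simp
  ring

lemma lap_sum_sq {x : E5} (hx : x ≠ 0) : lap (fun y => ∑ j, y j * y j) x = 10 := by
  have : ∀ i, pd i (pd i fun y => ∑ j, y j * y j) x = 2 := fun i => by
    rw [pd_congr (fun y hy => pd_sum_sq i hy) i hx, pd_const_mul, pd_coord]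
    simp
  simp only [lap, this]
  norm_num

lemma paneitz_eq_bilap {u : E5 → ℝ} (hu : SmoothOff (homExt u)) {x : E5} (hx : x ∈ S4) :
    paneitz u x = lap (lap (homExt u)) x := by
  have hx0 := ne_zero_of_mem_sphere hx
  have hr : ∑ j, x j * x j = 1 := by
    have := EuclideanSpace.real_norm_sq_eq x
    rw [mem_sphere_zero_iff_norm.1 hx] at this
    simpa [sq] using this.symm
  have hρ : SmoothOff (fun y => ∑ j, y j * y j) :=
    ContDiffOn.sum fun j _ => (smoothOff_coord j).mul (smoothOff_coord j)
  have hv : SmoothOff (homExt (sphereLap u)) :=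
    (hρ.mul hu.lap).congr fun y hy => homExt_sphereLap hu hy
  have he := (eulerHom_homExt hu).lap.sum_coord_mul_pd hx0
  have hs : ∑ i, 2 * x i * pd i (lap (homExt u)) x = 2 * ∑ i, x i * pd i (lap (homExt u)) x := by
    simp only [Finset.mul_sum, mul_assoc]
  have h1 : sphereLap (sphereLap u) x
      = lap (fun y => (∑ j, y j * y j) * lap (homExt u) y) x := by
    rw [sphereLap, eucLap_eq_lap hv hx0, lap_congr (fun y hy => homExt_sphereLap hu hy) hx0]
  rw [paneitz, h1, lap_mul hρ hu.lap hx0, lap_sum_sq hx0, hr, sphereLap, eucLap_eq_lap hu hx0]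
  simp only [pd_sum_sq _ hx0]
  rw [hs, he]
  ring

end PaneitzSphere

open PaneitzSphere

/-- Proposition 1.5: for `α ≠ 1`, any smooth solution of
`α P₄ u + 6(1 - e^{4u}) = 0` on `S⁴` with `∫ e^{4u} dw = 1` (normalized volume)
has vanishing first momentum and center of mass:
`∫ u ξᵢ dw = 0` and `∫ e^{4u} ξᵢ dw = 0` for `i = 1,…,5`. -/
theorem center_of_mass_vanishes (α : ℝ) (hα : 0 < α) (hα1 : α ≠ 1)
    (u : EuclideanSpace ℝ (Fin 5) → ℝ)
    (hu : ContDiffOn ℝ (⊤ : ℕ∞) (homExt u) {(0 : EuclideanSpace ℝ (Fin 5))}ᶜ)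
    (hnorm :
      ∫ x in Metric.sphere (0 : EuclideanSpace ℝ (Fin 5)) 1, Real.exp (4 * u x) ∂μH[4]
        = (μH[4] (Metric.sphere (0 : EuclideanSpace ℝ (Fin 5)) 1)).toReal)
    (hode : ∀ x ∈ Metric.sphere (0 : EuclideanSpace ℝ (Fin 5)) 1,
      α * paneitz u x + 6 * (1 - Real.exp (4 * u x)) = 0) :
    ∀ i : Fin 5,
      (∫ x in Metric.sphere (0 : EuclideanSpace ℝ (Fin 5)) 1, u x * x i ∂μH[4] = 0) ∧
      (∫ x in Metric.sphere (0 : EuclideanSpace ℝ (Fin 5)) 1,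
          Real.exp (4 * u x) * x i ∂μH[4] = 0) := by
  intro i
  set U := homExt u with hU
  have hE : EulerHom 0 U := eulerHom_homExt hu
  have hexp : EulerHom 0 (fun x => Real.exp (4 * U x)) := (hE.const_mul 4).exp
  have hfirst : ∫ x in Metric.sphere (0 : EuclideanSpace ℝ (Fin 5)) 1, u x * x i ∂μH[4]
      = ∫ x, U x * x i ∂surf :=
    integral_surf_congr fun x hx => by rw [hU, homExt_of_mem_sphere u hx]
  have hcenter : ∫ x in Metric.sphere (0 : EuclideanSpace ℝ (Fin 5)) 1,
      Real.exp (4 * u x) * x i ∂μH[4] = ∫ x, Real.exp (4 * U x) * x i ∂surf :=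
    integral_surf_congr fun x hx => by rw [hU, homExt_of_mem_sphere u hx]
  have heq : ∀ x ∈ S4, α * lap (lap U) x = 6 * Real.exp (4 * U x) - 6 := by
    intro x hx
    have := hode x hx
    rw [paneitz_eq_bilap hu hx] at this
    rw [hU, homExt_of_mem_sphere u hx, ← hU]
    linarith
  -- Testing the equation with the coordinate function.
  have htest : 24 * α * ∫ x, U x * x i ∂surf = 6 * ∫ x, Real.exp (4 * U x) * x i ∂surf := by
    have h1 : ∀ x ∈ S4, α * (x i * lap (lap U) x)
        = 6 * (Real.exp (4 * U x) * x i) - 6 * x i := fun x hx => by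
      linear_combination x i * heq x hx
    have h2 := integral_surf_congr h1
    rw [integral_sub ((hexp.mul (EulerHom.coord i)).smooth.integrable.const_mul _)
      ((smoothOff_coord i).integrable.const_mul _), integral_const_mul, integral_const_mul,
      integral_const_mul, EulerHom.integral_coord i, hE.integral_coord_mul_bilap i] at h2
    linarith
  -- The Kazdan–Warner identity.
  have hkw : ∫ x, Real.exp (4 * U x) * x i ∂surf = 4 * ∫ x, U x * x i ∂surf := by
    have h1 : ∀ x ∈ S4, α * (pd i U x * lap (lap U) x)
        = 6 * pd i (fun y => 1 / 4 * Real.exp (4 * U y) - U y) x := fun x hx => by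
      have hd := hE.smooth.differentiableAt (ne_zero_of_mem_sphere hx)
      have hpd : pd i (fun y => 1 / 4 * Real.exp (4 * U y) - U y) x
          = Real.exp (4 * U x) * pd i U x - pd i U x := by
        rw [pd, fderiv_fun_sub (((hd.const_mul 4).exp).const_mul _) hd, fderiv_mul_left,
          fderiv_exp (hd.const_mul 4), fderiv_mul_left]
        simp [pd]
        ring
      rw [hpd]
      linear_combination pd i U x * heq x hx
    have h2 := integral_surf_congr h1
    have h3 : ∀ x ∈ S4, x i * (1 / 4 * Real.exp (4 * U x) - U x)
        = 1 / 4 * (Real.exp (4 * U x) * x i) - U x * x i := fun x _ => by ring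
    rw [integral_const_mul, integral_const_mul, hE.integral_bilap_mul_pd i,
      ((hexp.const_mul (1 / 4)).sub hE).integral_pd i, integral_surf_congr h3,
      integral_sub ((hexp.mul (EulerHom.coord i)).smooth.integrable.const_mul _)
      (hE.mul (EulerHom.coord i)).smooth.integrable, integral_const_mul] at h2
    linarith
  have hzero : ∫ x, U x * x i ∂surf = 0 := by
    have h : (α - 1) * ∫ x, U x * x i ∂surf = 0 := by
      linear_combination (1 / 24) * htest + (1 / 4) * hkw
    exact (mul_eq_zero.1 h).resolve_left (sub_ne_zero.2 hα1)
  rw [hfirst, hcenter, hkw, hzero]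
  simp
end
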